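/- Let p ∈ (1,∞), q ∈ [1,∞] with conjugate exponent q*, and λ > 0. Then for every z ∈ ℝ^m and β ∈ ℝ^n, ‖z‖_p + (λ/δ_m(q,p))·‖β‖_{q*} ≤ max{‖z + Δβ‖_p : Δ ∈ ℝ^{m×n}, ‖Δ‖_{F_q} ≤ λ}. -/

import Mathlib

open scoped ENNReal

noncomputable def lpNorm (p : ℝ≥0∞) {ι : Type*} [Fintype ι] (x : ι → ℝ) : ℝ :=
  ‖(WithLp.equiv p (ι → ℝ)).symm x‖

noncomputable def frobNorm (p : ℝ≥0∞) {m n : ℕ} (A : Matrix (Fin m) (Fin n) ℝ) : ℝ :=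
  lpNorm p (fun ij : Fin m × Fin n => A ij.1 ij.2)

noncomputable def discrep (m : ℕ) (a b : ℝ≥0∞) : ℝ :=
  sSup {t : ℝ | ∃ u : Fin m → ℝ, lpNorm b u = 1 ∧ t = lpNorm a u}

theorem lpNorm_smul {ι : Type*} [Fintype ι] (p : ℝ≥0∞) (hp : 1 ≤ p) (c : ℝ) (x : ι → ℝ) :
    lpNorm p (c • x) = |c| * lpNorm p x := by
  have : Fact (1 ≤ p) := ⟨hp⟩
  exact norm_smul c (WithLp.toLp p x)

theorem lpNorm_nonneg {ι : Type*} [Fintype ι] (p : ℝ≥0∞) (hp : 1 ≤ p) (x : ι → ℝ) :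
    0 ≤ lpNorm p x := by
  have : Fact (1 ≤ p) := ⟨hp⟩
  exact norm_nonneg (WithLp.toLp p x)

theorem lpNorm_eq_zero {ι : Type*} [Fintype ι] (p : ℝ≥0∞) (hp : 1 ≤ p) (x : ι → ℝ) :
    lpNorm p x = 0 ↔ x = 0 := by
  have : Fact (1 ≤ p) := ⟨hp⟩
  exact (norm_eq_zero (a := WithLp.toLp p x)).trans (WithLp.toLp_eq_zero p)

theorem lpNorm_add_le {ι : Type*} [Fintype ι] (p : ℝ≥0∞) (hp : 1 ≤ p) (x y : ι → ℝ) :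
    lpNorm p (x + y) ≤ lpNorm p x + lpNorm p y := by
  have : Fact (1 ≤ p) := ⟨hp⟩
  exact norm_add_le (WithLp.toLp p x) (WithLp.toLp p y)

/-- Linear maps between finite-dimensional coordinate spaces are bounded for `ℓ_p` norms. -/
theorem exists_lpNorm_map_le {ι κ : Type*} [Fintype ι] [Fintype κ] (a b : ℝ≥0∞) (ha : 1 ≤ a)
    (hb : 1 ≤ b) (f : (ι → ℝ) →ₗ[ℝ] (κ → ℝ)) :
    ∃ C : ℝ, 0 ≤ C ∧ ∀ x, lpNorm a (f x) ≤ C * lpNorm b x := by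
  have : Fact (1 ≤ a) := ⟨ha⟩
  have : Fact (1 ≤ b) := ⟨hb⟩
  let g : PiLp b (fun _ : ι => ℝ) →ₗ[ℝ] PiLp a (fun _ : κ => ℝ) :=
    (WithLp.linearEquiv a ℝ (κ → ℝ)).symm.toLinearMap ∘ₗ f ∘ₗ
      (WithLp.linearEquiv b ℝ (ι → ℝ)).toLinearMap
  exact ⟨‖LinearMap.toContinuousLinearMap g‖, norm_nonneg _, fun x =>
    (LinearMap.toContinuousLinearMap g).le_opNorm (WithLp.toLp b x)⟩

theorem lpNorm_le_discrep {m : ℕ} (a b : ℝ≥0∞) (ha : 1 ≤ a) (hb : 1 ≤ b) (u : Fin m → ℝ)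
    (hu : lpNorm b u = 1) : lpNorm a u ≤ discrep m a b := by
  obtain ⟨C, -, hC⟩ := exists_lpNorm_map_le a b ha hb (LinearMap.id : (Fin m → ℝ) →ₗ[ℝ] _)
  refine le_csSup ⟨C, ?_⟩ ⟨u, hu, rfl⟩
  rintro _ ⟨v, hv, rfl⟩
  simpa [hv] using hC v

theorem discrep_nonneg {m : ℕ} (a b : ℝ≥0∞) (ha : 1 ≤ a) : 0 ≤ discrep m a b := by
  refine Real.sSup_nonneg ?_
  rintro _ ⟨v, -, rfl⟩
  exact lpNorm_nonneg a ha v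

theorem lpNorm_top {ι : Type*} [Fintype ι] (x : ι → ℝ) : lpNorm ⊤ x = ⨆ i, |x i| :=
  PiLp.norm_eq_ciSup (WithLp.toLp ⊤ x)

theorem lpNorm_eq_sum {ι : Type*} [Fintype ι] (p : ℝ≥0∞) (hp : 0 < p.toReal) (x : ι → ℝ) :
    lpNorm p x = (∑ i, |x i| ^ p.toReal) ^ (1 / p.toReal) :=
  PiLp.norm_eq_sum hp (WithLp.toLp p x)

theorem abs_le_lpNorm_top {ι : Type*} [Fintype ι] (x : ι → ℝ) (i : ι) : |x i| ≤ lpNorm ⊤ x := by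
  rw [lpNorm_top]
  exact le_ciSup (f := fun i => |x i|) (Set.finite_range _).bddAbove i

theorem frobNorm_vecMulVec_le {m n : ℕ} (q : ℝ≥0∞) (hq : 1 ≤ q) (u : Fin m → ℝ)
    (v : Fin n → ℝ) :
    frobNorm q (Matrix.vecMulVec u v) ≤ lpNorm q u * lpNorm q v := by
  unfold frobNorm
  rcases eq_or_ne q ⊤ with rfl | hq'
  · rw [lpNorm_top (ι := Fin m × Fin n)]
    refine Real.iSup_le (fun ij => ?_)
      (mul_nonneg (lpNorm_nonneg _ hq u) (lpNorm_nonneg _ hq v))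
    rw [Matrix.vecMulVec_apply, abs_mul]
    exact mul_le_mul (abs_le_lpNorm_top u _) (abs_le_lpNorm_top v _) (abs_nonneg _)
      (lpNorm_nonneg _ hq u)
  · have hpos : 0 < q.toReal := ENNReal.toReal_pos (zero_lt_one.trans_le hq).ne' hq'
    rw [lpNorm_eq_sum q hpos, lpNorm_eq_sum q hpos, lpNorm_eq_sum q hpos,
      ← Real.mul_rpow (by positivity) (by positivity), Fintype.sum_mul_sum, Fintype.sum_prod_type]
    simp only [Matrix.vecMulVec_apply, abs_mul, Real.mul_rpow (abs_nonneg _) (abs_nonneg _)]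
    exact le_rfl

theorem abs_sign_le_one (x : ℝ) : |Real.sign x| ≤ 1 := by
  rcases Real.sign_apply_eq x with h | h | h <;> simp [h]

theorem real_sign_mul_self (x : ℝ) : Real.sign x * x = |x| := by
  rcases lt_trichotomy x 0 with h | rfl | h
  · rw [Real.sign_of_neg h, abs_of_neg h]; ring
  · simp
  · rw [Real.sign_of_pos h, abs_of_pos h]; ring

/-- The `ℓ_{q*}` norm of a vector is attained by pairing with a vector in the `ℓ_q` unit ball. -/
theorem exists_lpNorm_dual_vector {ι : Type*} [Fintype ι] (q qs : ℝ≥0∞) (hq : 1 ≤ q)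
    (hqs : 1 / q + 1 / qs = 1) (β : ι → ℝ) :
    ∃ v : ι → ℝ, lpNorm q v ≤ 1 ∧ v ⬝ᵥ β = lpNorm qs β := by
  classical
  rcases eq_or_ne q ⊤ with rfl | hq'
  · have : qs = 1 := by simpa using hqs
    subst this
    refine ⟨fun i => Real.sign (β i), ?_, ?_⟩
    · rw [lpNorm_top]
      exact Real.iSup_le (fun i => abs_sign_le_one _) zero_le_one
    · simp [lpNorm_eq_sum 1 (by simp), dotProduct, real_sign_mul_self]
  rcases eq_or_ne qs ⊤ with rfl | hqs'
  · have : q = 1 := by simpa using hqs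
    subst this
    rcases isEmpty_or_nonempty ι with h | h
    · exact ⟨0, by simp [lpNorm_eq_sum 1 (by simp)], by simp [lpNorm_top, dotProduct]⟩
    · obtain ⟨i, hi⟩ := exists_eq_ciSup_of_finite (f := fun i => |β i|)
      refine ⟨Pi.single i (Real.sign (β i)), ?_, ?_⟩
      · rw [lpNorm_eq_sum _ (by simp), Finset.sum_eq_single i]
        · simpa using abs_sign_le_one _
        · intro j _ hj
          simp [hj]
        · simp
      · rw [single_dotProduct, real_sign_mul_self, lpNorm_top, ← hi]
  · have hpos : 0 < q.toReal := ENNReal.toReal_pos (zero_lt_one.trans_le hq).ne' hq'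
    have hqs0 : qs ≠ 0 := by
      rintro rfl
      simp at hqs
    have hspos : 0 < qs.toReal := ENNReal.toReal_pos hqs0 hqs'
    have hinv : q.toReal⁻¹ + qs.toReal⁻¹ = 1 := by
      have := congrArg ENNReal.toReal hqs
      rw [ENNReal.toReal_add (by simpa using (zero_lt_one.trans_le hq).ne') (by simpa using hqs0)]
        at this
      simpa using this
    have hconj : qs.toReal.HolderConjugate q.toReal := by
      refine ⟨by simpa [add_comm] using hinv, hspos, hpos⟩
    obtain ⟨g, hg, hgβ⟩ :=
      (NNReal.isGreatest_Lp (Finset.univ : Finset ι) (fun i => ‖β i‖₊) hconj).1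
    have hg' : ∑ i, (g i : ℝ) ^ q.toReal ≤ 1 := by exact_mod_cast hg
    have hgβ' : ∑ i, |β i| * (g i : ℝ) = (∑ i, |β i| ^ qs.toReal) ^ (1 / qs.toReal) := by
      simpa using congrArg NNReal.toReal hgβ
    refine ⟨fun i => Real.sign (β i) * g i, ?_, ?_⟩
    · rw [lpNorm_eq_sum q hpos]
      refine Real.rpow_le_one (by positivity) (le_trans (Finset.sum_le_sum fun i _ => ?_) hg')
        (by positivity)
      refine Real.rpow_le_rpow (abs_nonneg _) ?_ hpos.le
      rw [abs_mul, NNReal.abs_eq]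
      exact mul_le_of_le_one_left (g i).2 (abs_sign_le_one _)
    · rw [lpNorm_eq_sum qs hspos, ← hgβ']
      refine Finset.sum_congr rfl fun i _ => ?_
      rw [← real_sign_mul_self]
      ring

theorem bddAbove_lpNorm_add_mulVec {m n : ℕ} (p q : ℝ≥0∞) (hp : 1 ≤ p) (hq : 1 ≤ q) (lam : ℝ)
    (z : Fin m → ℝ) (β : Fin n → ℝ) :
    BddAbove {t : ℝ | ∃ Δ : Matrix (Fin m) (Fin n) ℝ, frobNorm q Δ ≤ lam ∧
      t = lpNorm p (z + Δ.mulVec β)} := by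
  let f : (Fin m × Fin n → ℝ) →ₗ[ℝ] (Fin m → ℝ) :=
    { toFun := fun A => (Matrix.of fun i j => A (i, j)).mulVec β
      map_add' := fun A B => Matrix.add_mulVec (.of fun i j => A (i, j)) (.of fun i j => B (i, j)) β
      map_smul' := fun c A => Matrix.smul_mulVec c (.of fun i j => A (i, j)) β }
  obtain ⟨C, hC0, hC⟩ := exists_lpNorm_map_le p q hp hq f
  refine ⟨lpNorm p z + C * lam, ?_⟩
  rintro _ ⟨Δ, hΔ, rfl⟩
  refine (lpNorm_add_le p hp _ _).trans (add_le_add le_rfl ?_)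
  exact (hC fun ij => Δ ij.1 ij.2).trans (mul_le_mul_of_nonneg_left hΔ hC0)

/-- Regularization lower bound for ℓ_p regression under q-Frobenius uncertainty. -/
theorem stmt12 {m n : ℕ} (p q qs : ℝ≥0∞) (hp1 : 1 < p) (hp2 : p ≠ ⊤) (hq : 1 ≤ q)
    (hqs : 1 / q + 1 / qs = 1) (lam : ℝ) (hlam : 0 < lam)
    (z : Fin m → ℝ) (β : Fin n → ℝ) :
    lpNorm p z + lam / discrep m q p * lpNorm qs β ≤
      sSup {t : ℝ | ∃ Δ : Matrix (Fin m) (Fin n) ℝ, frobNorm q Δ ≤ lam ∧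
        t = lpNorm p (z + Δ.mulVec β)} := by
  have hp := hp1.le
  by_cases hw : ∃ w : Fin m → ℝ, lpNorm p w = 1 ∧ z = lpNorm p z • w
  · obtain ⟨w, hw1, hzw⟩ := hw
    obtain ⟨v, hv1, hvβ⟩ := exists_lpNorm_dual_vector q qs hq hqs β
    have hc : 0 ≤ lam / discrep m q p := div_nonneg hlam.le (discrep_nonneg q p hq)
    have hqs1 : 1 ≤ qs := by
      have : 1 / qs ≤ 1 := le_add_self.trans_eq hqs
      simpa using this
    refine le_csSup (bddAbove_lpNorm_add_mulVec p q hp hq lam z β)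
      ⟨Matrix.vecMulVec ((lam / discrep m q p) • w) v, ?_, ?_⟩
    · refine (frobNorm_vecMulVec_le q hq _ v).trans
        ((mul_le_of_le_one_right (lpNorm_nonneg q hq _) hv1).trans ?_)
      rw [lpNorm_smul q hq, abs_of_nonneg hc]
      exact (mul_le_mul_of_nonneg_left (lpNorm_le_discrep q p hq hp w hw1) hc).trans
        (by
          rw [div_mul_comm]
          exact mul_le_of_le_one_left hlam.le (div_self_le_one _))
    · have h : z + (Matrix.vecMulVec ((lam / discrep m q p) • w) v).mulVec β =
          (lpNorm p z + lam / discrep m q p * lpNorm qs β) • w := by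
        rw [add_smul, ← hzw, Matrix.vecMulVec_mulVec, hvβ]
        ext i
        simp
        ring
      rw [h, lpNorm_smul p hp, hw1, mul_one, abs_of_nonneg
        (add_nonneg (lpNorm_nonneg p hp z) (mul_nonneg hc (lpNorm_nonneg qs hqs1 β)))]
  · have hz : lpNorm p z = 0 := by
      by_contra hz
      refine hw ⟨(lpNorm p z)⁻¹ • z, ?_, by rw [smul_inv_smul₀ hz]⟩
      rw [lpNorm_smul p hp, abs_of_nonneg (inv_nonneg.2 (lpNorm_nonneg p hp z)),
        inv_mul_cancel₀ hz]
    have hd : discrep m q p = 0 := by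
      have hempty : {t : ℝ | ∃ u : Fin m → ℝ, lpNorm p u = 1 ∧ t = lpNorm q u} = ∅ := by
        refine Set.eq_empty_of_forall_notMem ?_
        rintro _ ⟨u, hu, -⟩
        exact hw ⟨u, hu, by rw [hz, zero_smul, (lpNorm_eq_zero p hp z).1 hz]⟩
      rw [discrep, hempty, Real.sSup_empty]
    rw [hz, hd, div_zero, zero_mul, add_zero]
    refine Real.sSup_nonneg ?_
    rintro _ ⟨Δ, -, rfl⟩
    exact lpNorm_nonneg p hp _
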